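/- Let C ⊆ ℝ^n be a nonempty convex compact set, f : C × C → ℝ an equilibrium bifunction, K : C ⇉ C lower semicontinuous with nonempty convex values and fix K closed. Let A ⊇ C be a set open in the affine hull aff C, and let f̂ : C × A → ℝ satisfy f̂(x,y) = f(x,y) for all (x,y) ∈ C × C. Define F̂ : C ⇉ A by F̂(x) := {y ∈ A : f̂(x,y) < 0}. Assume: (i) F̂(x) is convex for every x ∈ fix K; (ii) F̂ has open lower sections at every point of fix K, i.e. for every y ∈ A the set F̂⁻¹(y) := {x ∈ C : y ∈ F̂(x)} is open in the relative topology that fix K inherits; (iii) F̂(x) is open in aff C for every x ∈ ∂_C fix K. Then the quasiequilibrium problem has a solution: there exists x ∈ K(x) with f(x,y) ≥ 0 for all y ∈ K(x). -/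

import Mathlib

open Set Topology Filter

/-- A set-valued map `Φ : X ⇉ Y` is lower semicontinuous at `x` if for every open set `Ω`
with `Φ x ∩ Ω ≠ ∅` there is a neighborhood of `x` on which `Φ x' ∩ Ω ≠ ∅`. -/
def LscAt {X Y : Type*} [TopologicalSpace X] [TopologicalSpace Y]
    (Φ : X → Set Y) (x : X) : Prop :=
  ∀ Ω : Set Y, IsOpen Ω → (Φ x ∩ Ω).Nonempty → ∀ᶠ x' in 𝓝 x, (Φ x' ∩ Ω).Nonempty

/-- `σ` is dominant with respect to the set `D` of linear preorders `r i` when no element of `T`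
lies strictly above some element of `σ` in every `r i`, `i ∈ D`. -/
def ScarfDominant {T I L : Type*} [LinearOrder L] (r : I → T → L) (σ : Finset T)
    (D : Finset I) : Prop :=
  ∀ y : T, ∃ i ∈ D, ∀ x ∈ σ, r i y ≤ r i x

/-- A map whose image has one element fewer than its domain identifies exactly one pair. -/
theorem Finset.exists_unique_collision {α β : Type*} [DecidableEq α] [DecidableEq β]
    {s : Finset α} {f : α → β} (h : s.card = (s.image f).card + 1) :
    ∃ a ∈ s, ∃ b ∈ s, a ≠ b ∧ f a = f b ∧
      ∀ x ∈ s, ∀ y ∈ s, x ≠ y → f x = f y → x = a ∧ y = b ∨ x = b ∧ y = a := by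
  have hni : ¬ Set.InjOn f s := fun hi => by
    rw [Finset.card_image_of_injOn hi] at h; omega
  simp only [Set.InjOn, not_forall] at hni
  obtain ⟨a, ha, b, hb, hab, hne⟩ := hni
  have key : ∀ c ∈ s, ∀ d ∈ s, c ≠ d → f c = f d → Set.InjOn f (s.erase c) := by
    intro c hc d hd hcd hfcd
    rw [← Finset.card_image_iff]
    have : (s.erase c).image f = s.image f := by
      apply Finset.Subset.antisymm (Finset.image_subset_image (Finset.erase_subset _ _))
      intro z hz
      obtain ⟨x, hx, rfl⟩ := Finset.mem_image.1 hz
      by_cases hxc : x = c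
      · exact Finset.mem_image.2 ⟨d, Finset.mem_erase.2 ⟨hcd.symm, hd⟩, by rw [hxc, hfcd]⟩
      · exact Finset.mem_image_of_mem _ (Finset.mem_erase.2 ⟨hxc, hx⟩)
    rw [this, Finset.card_erase_of_mem hc]; omega
  have h1 := key a ha b hb hne hab
  have h2 := key b hb a ha (Ne.symm hne) hab.symm
  refine ⟨a, ha, b, hb, hne, hab, fun x hx y hy hxy hfxy => ?_⟩
  by_contra hcon
  have e1 : x = a ∨ y = a := by
    by_contra! h'
    exact hxy (h1 (by simp [h'.1, Finset.mem_coe.1 hx]) (by simp [h'.2, Finset.mem_coe.1 hy]) hfxy)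
  have e2 : x = b ∨ y = b := by
    by_contra! h'
    exact hxy (h2 (by simp [h'.1, Finset.mem_coe.1 hx]) (by simp [h'.2, Finset.mem_coe.1 hy]) hfxy)
  grind

section Scarf

variable {T I L : Type*} [LinearOrder L] {r : I → T → L}

theorem ScarfDominant.mono {σ τ : Finset T} {C D : Finset I} (h : ScarfDominant r σ C)
    (hτ : τ ⊆ σ) (hD : C ⊆ D) : ScarfDominant r τ D := fun y =>
  let ⟨i, hi, hx⟩ := h y
  ⟨i, hD hi, fun x hxτ => hx x (hτ hxτ)⟩

variable [DecidableEq T] [DecidableEq I]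

/-- `(σ, C)` is a room adjacent to the door `(τ, D)`. -/
def ScarfAdj (r : I → T → L) (τ : Finset T) (D : Finset I) (ρ : Finset T × Finset I) : Prop :=
  ScarfDominant r ρ.1 ρ.2 ∧ ρ.1.card = ρ.2.card ∧ τ ⊆ ρ.1 ∧ ρ.2 ⊆ D

theorem ScarfAdj.cases {τ σ : Finset T} {C D : Finset I} (hcard : D.card = τ.card + 1)
    (h : ScarfAdj r τ D (σ, C)) :
    (σ = τ ∧ ∃ j ∈ D, C = D.erase j) ∨ (C = D ∧ ∃ x, x ∉ τ ∧ σ = insert x τ) := by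
  obtain ⟨-, h2, h3, h4⟩ := h
  simp only at h2 h3 h4
  have c3 := Finset.card_le_card h3
  have c4 := Finset.card_le_card h4
  by_cases hσ : σ.card = τ.card
  · left
    refine ⟨(Finset.eq_of_subset_of_card_le h3 hσ.le).symm, ?_⟩
    obtain ⟨j, hj, hjC⟩ := Finset.exists_mem_notMem_of_card_lt_card (s := C) (t := D) (by omega)
    refine ⟨j, hj, Finset.eq_of_subset_of_card_le (fun i hi => ?_) ?_⟩
    · exact Finset.mem_erase.2 ⟨fun e => hjC (e ▸ hi), h4 hi⟩
    · rw [Finset.card_erase_of_mem hj]; omega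
  · right
    refine ⟨Finset.eq_of_subset_of_card_le h4 (by omega), ?_⟩
    obtain ⟨x, hx, hxτ⟩ := Finset.exists_mem_notMem_of_card_lt_card (s := τ) (t := σ) (by omega)
    refine ⟨x, hxτ, (Finset.eq_of_subset_of_card_le (Finset.insert_subset hx h3) ?_).symm⟩
    rw [Finset.card_insert_of_notMem hxτ]; omega

/-- Passing a door whose minimum for index `k` is redundant leads to exactly one room in which
all other minima are kept. -/
theorem ScarfDominant.existsUnique_room [Fintype T] {τ : Finset T} {D : Finset I}
    (hr : ∀ i, Function.Injective (r i)) (hτD : ScarfDominant r τ D)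
    (hcard : D.card = τ.card + 1) {m : I → T} (hmτ : ∀ i, m i ∈ τ)
    (hm : ∀ i, ∀ x ∈ τ, r i (m i) ≤ r i x)
    {k k' : I} (hk : k ∈ D) (hk' : k' ∈ D) (hkk : k ≠ k') (hmk : m k = m k') :
    ∃! ρ : Finset T × Finset I, ScarfAdj r τ D ρ ∧
      ∀ i ∈ D, i ≠ k → i ∈ ρ.2 ∧ ∀ x ∈ ρ.1, r i (m i) ≤ r i x := by
  classical
  have hstrict : ∀ i x, x ∉ τ → r i (m i) ≤ r i x → r i (m i) < r i x := fun i x hx h =>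
    lt_of_le_of_ne h fun e => hx (hr i e ▸ hmτ i)
  set A : Finset T := Finset.univ.filter fun y => ∀ i ∈ D, i ≠ k → r i (m i) < r i y with hA
  have memA : ∀ y, y ∈ A ↔ ∀ i ∈ D, i ≠ k → r i (m i) < r i y := fun y => by simp [hA]
  have hAk : ∀ y ∈ A, ∀ x ∈ τ, r k y ≤ r k x := by
    intro y hy
    obtain ⟨i, hi, hix⟩ := hτD y
    by_cases hik : i = k
    · exact hik ▸ hix
    · exact absurd (hix _ (hmτ i)) (not_le.2 ((memA y).1 hy i hi hik))
  rcases A.eq_empty_or_nonempty with hAe | hAne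
  · refine ⟨(τ, D.erase k), ⟨⟨fun y => ?_, ?_, Finset.Subset.refl _, Finset.erase_subset _ _⟩,
      fun i hi hik => ⟨Finset.mem_erase.2 ⟨hik, hi⟩, hm i⟩⟩, ?_⟩
    · have hy : y ∉ A := by simp [hAe]
      rw [memA] at hy
      push Not at hy
      obtain ⟨i, hi, hik, hle⟩ := hy
      exact ⟨i, Finset.mem_erase.2 ⟨hik, hi⟩, fun x hx => hle.trans (hm i x hx)⟩
    · simp only [Finset.card_erase_of_mem hk]; omega
    · rintro ⟨σ, C⟩ ⟨hadj, hB⟩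
      rcases hadj.cases hcard with ⟨rfl, j, hj, rfl⟩ | ⟨rfl, x, hx, rfl⟩
      · have : j = k := by
          by_contra hjk
          simpa using (hB j hj hjk).1
        rw [this]
      · have : x ∈ A := (memA x).2 fun i hi hik =>
          hstrict i x hx ((hB i hi hik).2 x (Finset.mem_insert_self _ _))
        simp [hAe] at this
  · obtain ⟨a, haA, hamax⟩ := A.exists_max_image (r k) hAne
    have haA' := (memA a).1 haA
    have haτ : a ∉ τ := by
      intro ha
      obtain ⟨i, hi, hix⟩ := hτD a
      have hmi : m i = a := hr i (le_antisymm (hm i a ha) (hix _ (hmτ i)))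
      by_cases hik : i = k
      · have := haA' k' hk' hkk.symm
        rw [← hmk, ← hik, hmi] at this
        exact lt_irrefl _ this
      · have := haA' i hi hik
        rw [hmi] at this
        exact lt_irrefl _ this
    refine ⟨(insert a τ, D), ⟨⟨fun y => ?_, ?_, Finset.subset_insert _ _, Finset.Subset.refl _⟩,
      fun i hi hik => ⟨hi, fun x hx => ?_⟩⟩, ?_⟩
    · by_cases hy : y ∈ A
      · refine ⟨k, hk, fun x hx => ?_⟩
        rcases Finset.mem_insert.1 hx with rfl | hx
        · exact hamax y hy
        · exact hAk y hy x hx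
      · rw [memA] at hy
        push Not at hy
        obtain ⟨i, hi, hik, hle⟩ := hy
        refine ⟨i, hi, fun x hx => ?_⟩
        rcases Finset.mem_insert.1 hx with rfl | hx
        · exact hle.trans (haA' i hi hik).le
        · exact hle.trans (hm i x hx)
    · simp only [Finset.card_insert_of_notMem haτ]; omega
    · rcases Finset.mem_insert.1 hx with rfl | hx
      · exact (haA' i hi hik).le
      · exact hm i x hx
    · rintro ⟨σ, C⟩ ⟨hadj, hB⟩
      have hdom := hadj.1
      rcases hadj.cases hcard with ⟨rfl, j, hj, rfl⟩ | ⟨rfl, x, hx, rfl⟩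
      · have : j = k := by
          by_contra hjk
          simpa using (hB j hj hjk).1
        obtain ⟨i, hi, hix⟩ := hdom a
        rw [this] at hi
        have hi' := Finset.mem_erase.1 hi
        exact absurd (hix _ (hmτ i)) (not_le.2 (haA' i hi'.2 hi'.1))
      · have hxA : x ∈ A := (memA x).2 fun i hi hik =>
          hstrict i x hx ((hB i hi hik).2 x (Finset.mem_insert_self _ _))
        obtain ⟨i, hi, hix⟩ := hdom a
        by_cases hik : i = k
        · have h1 := hix x (Finset.mem_insert_self _ _)
          rw [hik] at h1
          rw [hr k (le_antisymm (hamax x hxA) h1)]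
        · exact absurd (hix _ (Finset.mem_insert_of_mem (hmτ i))) (not_le.2 (haA' i hi hik))

/-- Every door `(τ, D)` with `τ` nonempty belongs to exactly two rooms. -/
theorem ScarfDominant.exists_two_rooms [Fintype T] {τ : Finset T} {D : Finset I}
    (hr : ∀ i, Function.Injective (r i)) (hτD : ScarfDominant r τ D)
    (hcard : D.card = τ.card + 1) (hne : τ.Nonempty) :
    ∃ ρ₁ ρ₂ : Finset T × Finset I, ρ₁ ≠ ρ₂ ∧ ∀ ρ, ScarfAdj r τ D ρ ↔ ρ = ρ₁ ∨ ρ = ρ₂ := by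
  choose m hmτ hm using fun i => τ.exists_min_image (r i) hne
  have hmin : ∀ i, ∀ z ∈ τ, (∀ x ∈ τ, r i z ≤ r i x) → m i = z := fun i z hz h =>
    hr i (le_antisymm (hm i z hz) (h _ (hmτ i)))
  have himg : D.image m = τ := by
    apply Finset.Subset.antisymm
    · exact Finset.image_subset_iff.2 fun i _ => hmτ i
    · intro z hz
      obtain ⟨i, hi, hix⟩ := hτD z
      exact Finset.mem_image.2 ⟨i, hi, hmin i z hz hix⟩
  obtain ⟨a, ha, b, hb, hab, hmab, huniq⟩ :=
    Finset.exists_unique_collision (s := D) (f := m) (by rw [himg]; exact hcard)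
  obtain ⟨ρ₁, ⟨h1, hB1⟩, hu1⟩ := hτD.existsUnique_room hr hcard hmτ hm ha hb hab hmab
  obtain ⟨ρ₂, ⟨h2, hB2⟩, hu2⟩ := hτD.existsUnique_room hr hcard hmτ hm hb ha hab.symm hmab.symm
  refine ⟨ρ₁, ρ₂, ?_, fun ρ => ⟨fun hρ => ?_, ?_⟩⟩
  · rintro rfl
    have hB : ∀ i ∈ D, i ∈ ρ₁.2 ∧ ∀ x ∈ ρ₁.1, r i (m i) ≤ r i x := fun i hi => by
      by_cases hia : i = a
      · exact hB2 i hi (hia ▸ hab)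
      · exact hB1 i hi hia
    obtain ⟨σ, C⟩ := ρ₁
    rcases h1.cases hcard with ⟨rfl, j, hj, rfl⟩ | ⟨rfl, x, hx, rfl⟩
    · simpa using (hB j hj).1
    · obtain ⟨i, hi, hix⟩ := h1.1 x
      have e := (hB i hi).2 x (Finset.mem_insert_self _ _)
      have e' := hix (m i) (Finset.mem_insert_of_mem (hmτ i))
      exact hx (hr i (le_antisymm e e') ▸ hmτ i)
  · have hdom := hρ.1
    suffices h : (∀ i ∈ D, i ≠ a → i ∈ ρ.2 ∧ ∀ x ∈ ρ.1, r i (m i) ≤ r i x) ∨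
        (∀ i ∈ D, i ≠ b → i ∈ ρ.2 ∧ ∀ x ∈ ρ.1, r i (m i) ≤ r i x) from
      h.imp (fun h => hu1 ρ ⟨hρ, h⟩) (fun h => hu2 ρ ⟨hρ, h⟩)
    obtain ⟨σ, C⟩ := ρ
    simp only at hdom ⊢
    rcases hρ.cases hcard with ⟨rfl, j, hj, rfl⟩ | ⟨rfl, x, hx, rfl⟩
    · obtain ⟨i, hi, hix⟩ := hdom (m j)
      obtain ⟨hij, hi⟩ := Finset.mem_erase.1 hi
      have hj' : ∀ i ∈ D, i ≠ j → i ∈ D.erase j ∧ ∀ x ∈ σ, r i (m i) ≤ r i x :=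
        fun i hi hij => ⟨Finset.mem_erase.2 ⟨hij, hi⟩, hm i⟩
      rcases huniq i hi j hj hij (hmin i _ (hmτ j) hix) with ⟨-, h⟩ | ⟨-, h⟩
      · exact Or.inr (h ▸ hj')
      · exact Or.inl (h ▸ hj')
    · have hpt : ∀ l ∈ C, ∃ l' ∈ C, m l' = m l ∧ r l' (m l) ≤ r l' x := fun l hl => by
        obtain ⟨l', hl', hlx⟩ := hdom (m l)
        exact ⟨l', hl', hmin l' _ (hmτ l) fun z hz => hlx z (Finset.mem_insert_of_mem hz),
          hlx x (Finset.mem_insert_self _ _)⟩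
      obtain ⟨i, hi, hix⟩ := hdom x
      have hlt : r i x < r i (m i) :=
        lt_of_le_of_ne (hix _ (Finset.mem_insert_of_mem (hmτ i))) fun e => hx (hr i e ▸ hmτ i)
      obtain ⟨i', hi', hmi, hlei⟩ := hpt i hi
      have hne' : i' ≠ i := by
        rintro rfl
        exact absurd hlei (not_le.2 hlt)
      have hBi : ∀ l ∈ C, l ≠ i → l ∈ C ∧ ∀ z ∈ insert x τ, r l (m l) ≤ r l z := by
        intro l hl hli
        refine ⟨hl, fun z hz => ?_⟩
        rcases Finset.mem_insert.1 hz with rfl | hz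
        · obtain ⟨l', hl', hml, hlel⟩ := hpt l hl
          by_cases hll : l' = l
          · rwa [hll] at hlel
          · have e1 := huniq l' hl' l hl hll hml
            have e2 := huniq i' hi' i hi hne' hmi
            have : l' = i := by grind
            subst this
            rw [← hml] at hlel
            exact absurd hlel (not_le.2 hlt)
        · exact hm l z hz
      rcases huniq i' hi' i hi hne' hmi with ⟨-, h⟩ | ⟨-, h⟩
      · exact Or.inr (h ▸ hBi)
      · exact Or.inl (h ▸ hBi)
  · rintro (rfl | rfl)
    exacts [h1, h2]

/-- If no room is fully coloured, then a room containing all colours of `C` but `i₀` has exactly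
two doors of the same kind. -/
theorem exists_two_doors {c : T → I} {i₀ : I} {σ : Finset T} {C : Finset I}
    (hdom : ScarfDominant r σ C) (hcard : σ.card = C.card) (hi₀ : i₀ ∈ C)
    (hC : C ⊆ insert i₀ (σ.image c)) (hne : σ.image c ≠ C) :
    ∃ τ₁ τ₂ : Finset T, τ₁ ≠ τ₂ ∧ ∀ τ : Finset T, (Set.InjOn c τ ∧ i₀ ∉ τ.image c ∧
      ScarfDominant r τ (insert i₀ (τ.image c)) ∧ τ ⊆ σ ∧ C ⊆ insert i₀ (τ.image c)) ↔
        τ = τ₁ ∨ τ = τ₂ := by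
  have hσi₀ : i₀ ∉ σ.image c := by
    intro h
    rw [Finset.insert_eq_of_mem h] at hC
    exact hne (Finset.eq_of_subset_of_card_le hC (hcard ▸ Finset.card_image_le)).symm
  have hsimp : ∀ τ : Finset T, (Set.InjOn c τ ∧ i₀ ∉ τ.image c ∧
      ScarfDominant r τ (insert i₀ (τ.image c)) ∧ τ ⊆ σ ∧ C ⊆ insert i₀ (τ.image c)) ↔
      Set.InjOn c τ ∧ τ ⊆ σ ∧ C ⊆ insert i₀ (τ.image c) := fun τ =>
    ⟨fun h => ⟨h.1, h.2.2.2.1, h.2.2.2.2⟩, fun h => ⟨h.1,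
      fun h' => hσi₀ (Finset.image_subset_image h.2.1 h'), hdom.mono h.2.1 h.2.2, h.2⟩⟩
  simp only [hsimp]
  have hτcases : ∀ τ : Finset T, Set.InjOn c τ → τ ⊆ σ → C ⊆ insert i₀ (τ.image c) →
      τ = σ ∨ ∃ x ∈ σ, τ = σ.erase x := by
    intro τ h1 h2 h3
    by_cases h : τ = σ
    · exact Or.inl h
    · obtain ⟨x, hx, hxτ⟩ := Finset.exists_of_ssubset (h2.ssubset_of_ne h)
      refine Or.inr ⟨x, hx, Finset.eq_of_subset_of_card_le
        (fun z hz => Finset.mem_erase.2 ⟨fun e => hxτ (e ▸ hz), h2 hz⟩) ?_⟩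
      have := Finset.card_le_card h3
      have h4 := Finset.card_insert_le i₀ (τ.image c)
      have h5 : (τ.image c).card ≤ τ.card := Finset.card_image_le
      rw [Finset.card_erase_of_mem hx]
      omega
  have hc1 := Finset.card_le_card hC
  rw [Finset.card_insert_of_notMem hσi₀] at hc1
  have hc2 : (σ.image c).card ≤ σ.card := Finset.card_image_le
  by_cases hinj : Set.InjOn c σ
  · have hcI := Finset.card_image_of_injOn hinj
    obtain ⟨j, hj, hjC⟩ := Finset.exists_mem_notMem_of_card_lt_card
      (s := C) (t := insert i₀ (σ.image c)) (by rw [Finset.card_insert_of_notMem hσi₀]; omega)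
    have hji : j ≠ i₀ := fun e => hjC (e ▸ hi₀)
    obtain ⟨x, hx, rfl⟩ := Finset.mem_image.1 (Finset.mem_of_mem_insert_of_ne hj hji)
    refine ⟨σ, σ.erase x, (Finset.erase_ne_self.2 hx).symm, fun τ => ⟨?_, ?_⟩⟩
    · rintro ⟨h1, h2, h3⟩
      rcases hτcases τ h1 h2 h3 with rfl | ⟨y, hy, rfl⟩
      · exact Or.inl rfl
      · right
        have hCe : C = insert i₀ ((σ.erase y).image c) := by
          apply Finset.eq_of_subset_of_card_le h3
          have h4 := Finset.card_insert_le i₀ ((σ.erase y).image c)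
          have h5 : ((σ.erase y).image c).card ≤ (σ.erase y).card := Finset.card_image_le
          have h6 := Finset.card_pos.2 ⟨y, hy⟩
          rw [Finset.card_erase_of_mem hy] at h5
          omega
        have : x = y := by
          by_contra hxy
          refine hjC (hCe ▸ Finset.mem_insert_of_mem (Finset.mem_image_of_mem _ ?_))
          exact Finset.mem_erase.2 ⟨hxy, hx⟩
        rw [this]
    · rintro (rfl | rfl)
      · exact ⟨hinj, Finset.Subset.refl _, hC⟩
      · refine ⟨hinj.mono (by simp), Finset.erase_subset _ _, fun i hi => ?_⟩
        rcases Finset.mem_insert.1 (hC hi) with rfl | h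
        · exact Finset.mem_insert_self _ _
        · obtain ⟨z, hz, rfl⟩ := Finset.mem_image.1 h
          refine Finset.mem_insert_of_mem (Finset.mem_image_of_mem _ (Finset.mem_erase.2 ⟨?_, hz⟩))
          rintro rfl
          exact hjC hi
  · have hlt : (σ.image c).card ≠ σ.card := fun h => hinj (Finset.card_image_iff.1 h)
    obtain ⟨a, ha, b, hb, hab, hcab, hu⟩ :=
      Finset.exists_unique_collision (s := σ) (f := c) (by omega)
    have hdoor : ∀ x ∈ σ, ∀ y ∈ σ, x ≠ y → c x = c y →
        (∀ z ∈ σ, ∀ w ∈ σ, z ≠ w → c z = c w → z = x ∧ w = y ∨ z = y ∧ w = x) →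
        Set.InjOn c (σ.erase x) ∧ σ.erase x ⊆ σ ∧ C ⊆ insert i₀ ((σ.erase x).image c) := by
      intro x hx y hy hxy hcxy hu
      refine ⟨fun z hz w hw hzw => ?_, Finset.erase_subset _ _, fun i hi => ?_⟩
      · by_contra hne
        have hz' := Finset.mem_erase.1 (Finset.mem_coe.1 hz)
        have hw' := Finset.mem_erase.1 (Finset.mem_coe.1 hw)
        rcases hu z hz'.2 w hw'.2 hne hzw with h | h
        · exact hz'.1 h.1
        · exact hw'.1 h.2
      · rcases Finset.mem_insert.1 (hC hi) with rfl | h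
        · exact Finset.mem_insert_self _ _
        · obtain ⟨z, hz, rfl⟩ := Finset.mem_image.1 h
          refine Finset.mem_insert_of_mem (Finset.mem_image.2 ?_)
          by_cases hzx : z = x
          · exact ⟨y, Finset.mem_erase.2 ⟨hxy.symm, hy⟩, by rw [hzx, hcxy]⟩
          · exact ⟨z, Finset.mem_erase.2 ⟨hzx, hz⟩, rfl⟩
    refine ⟨σ.erase a, σ.erase b, fun e => ?_, fun τ => ⟨?_, ?_⟩⟩
    · have : a ∈ σ.erase b := Finset.mem_erase.2 ⟨hab, ha⟩
      rw [← e] at this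
      simp at this
    · rintro ⟨h1, h2, h3⟩
      rcases hτcases τ h1 h2 h3 with rfl | ⟨y, hy, rfl⟩
      · exact absurd h1 hinj
      · by_contra! hy'
        have hya : a ≠ y := fun e => hy'.1 (e ▸ rfl)
        have hyb : b ≠ y := fun e => hy'.2 (e ▸ rfl)
        exact hab (h1 (by simp [hya, ha]) (by simp [hyb, hb]) hcab)
    · rintro (rfl | rfl)
      · exact hdoor a ha b hb hab hcab hu
      · exact hdoor b hb a ha hab.symm hcab.symm fun z hz w hw h h' => (hu z hz w hw h h').symm

/-- **Scarf's lemma** for linear orders: some dominant set carries exactly the colours with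
respect to which it is dominant. -/
theorem exists_scarfDominant_image [Fintype T] [Fintype I] [Nonempty T] [Nonempty I]
    (hr : ∀ i, Function.Injective (r i)) (c : T → I) :
    ∃ σ : Finset T, ScarfDominant r σ (σ.image c) := by
  classical
  by_contra! hno
  obtain ⟨i₀⟩ := ‹Nonempty I›
  set doors : Finset (Finset T) := Finset.univ.filter fun τ =>
    Set.InjOn c τ ∧ i₀ ∉ τ.image c ∧ ScarfDominant r τ (insert i₀ (τ.image c)) with hdoors
  set rooms : Finset (Finset T × Finset I) := Finset.univ.filter fun ρ =>
    ScarfDominant r ρ.1 ρ.2 ∧ ρ.1.card = ρ.2.card ∧ i₀ ∈ ρ.2 ∧ ρ.2 ⊆ insert i₀ (ρ.1.image c)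
    with hrooms
  let R : Finset T → Finset T × Finset I → Prop := fun τ ρ =>
    τ ⊆ ρ.1 ∧ ρ.2 ⊆ insert i₀ (τ.image c)
  have hsum := Finset.sum_card_bipartiteAbove_eq_sum_card_bipartiteBelow (s := doors) (t := rooms) R
  have hbelow : ∀ ρ ∈ rooms, (doors.bipartiteBelow R ρ).card = 2 := by
    intro ρ hρ
    obtain ⟨h1, h2, h3, h4⟩ := (Finset.mem_filter.1 hρ).2
    obtain ⟨τ₁, τ₂, hne, h⟩ := exists_two_doors h1 h2 h3 h4 fun e => hno ρ.1 (e ▸ h1)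
    refine Finset.card_eq_two.2 ⟨τ₁, τ₂, hne, ?_⟩
    ext τ
    rw [Finset.mem_insert, Finset.mem_singleton, ← h τ]
    simp [Finset.mem_bipartiteBelow, hdoors, R, and_assoc]
  have habove : ∀ τ ∈ doors, ∀ ρ, ρ ∈ rooms.bipartiteAbove R τ ↔
      ScarfAdj r τ (insert i₀ (τ.image c)) ρ := by
    intro τ hτ ρ
    simp only [Finset.mem_bipartiteAbove, hrooms, Finset.mem_filter, Finset.mem_univ, true_and, R,
      ScarfAdj]
    refine ⟨fun h => ⟨h.1.1, h.1.2.1, h.2⟩, fun h => ?_⟩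
    have hsub : ρ.2 ⊆ insert i₀ (ρ.1.image c) :=
      h.2.2.2.trans (Finset.insert_subset_insert _ (Finset.image_subset_image h.2.2.1))
    refine ⟨⟨h.1, h.2.1, ?_, hsub⟩, h.2.2⟩
    by_contra hi
    have hsub' : ρ.2 ⊆ ρ.1.image c := fun i hi' =>
      Finset.mem_of_mem_insert_of_ne (hsub hi') fun e => hi (e ▸ hi')
    have := Finset.eq_of_subset_of_card_le hsub' (h.2.1 ▸ Finset.card_image_le)
    exact hno ρ.1 (this ▸ h.1)
  have hcardD : ∀ τ ∈ doors, (insert i₀ (τ.image c)).card = τ.card + 1 := by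
    intro τ hτ
    obtain ⟨h1, h2, -⟩ := (Finset.mem_filter.1 hτ).2
    rw [Finset.card_insert_of_notMem h2, Finset.card_image_of_injOn h1]
  have hempty : ∅ ∈ doors := by
    simp [hdoors, ScarfDominant]
  have habove2 : ∀ τ ∈ doors.erase ∅, (rooms.bipartiteAbove R τ).card = 2 := by
    intro τ hτ
    obtain ⟨hτe, hτ⟩ := Finset.mem_erase.1 hτ
    obtain ⟨ρ₁, ρ₂, hne, h⟩ := ((Finset.mem_filter.1 hτ).2.2.2).exists_two_rooms hr
      (hcardD τ hτ) (Finset.nonempty_iff_ne_empty.2 hτe)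
    refine Finset.card_eq_two.2 ⟨ρ₁, ρ₂, hne, ?_⟩
    ext ρ
    rw [habove τ hτ, h, Finset.mem_insert, Finset.mem_singleton]
  have habove1 : (rooms.bipartiteAbove R ∅).card = 1 := by
    obtain ⟨a, -, ha⟩ := (Finset.univ : Finset T).exists_max_image (r i₀) Finset.univ_nonempty
    refine Finset.card_eq_one.2 ⟨({a}, {i₀}), ?_⟩
    ext ⟨σ, C⟩
    rw [habove ∅ hempty, Finset.mem_singleton, Prod.mk.injEq]
    constructor
    · intro h
      have hdom := h.1
      rcases h.cases (hcardD ∅ hempty) with ⟨rfl, j, hj, rfl⟩ | ⟨rfl, x, hx, rfl⟩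
      · obtain ⟨i, hi, -⟩ := hdom a
        simp at hi hj
        exact absurd hi.2 (hj ▸ hi.1)
      · obtain ⟨i, hi, hix⟩ := hdom a
        simp at hi hix
        subst hi
        have := hr i (le_antisymm hix (ha x (Finset.mem_univ _)))
        simp [this]
    · rintro ⟨rfl, rfl⟩
      refine ⟨fun y => ⟨i₀, by simp, fun x hx => ?_⟩, by simp, by simp, by simp⟩
      rw [Finset.mem_singleton.1 hx]
      exact ha y (Finset.mem_univ _)
  rw [Finset.sum_congr rfl hbelow, ← Finset.add_sum_erase _ _ hempty, habove1,
    Finset.sum_congr rfl habove2] at hsum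
  simp at hsum
  omega

end Scarf

theorem exists_approx_le_stdSimplex {I : Type*} [Fintype I] [Nonempty I]
    (f : (I → ℝ) → (I → ℝ)) (hf : MapsTo f (stdSimplex ℝ I) (stdSimplex ℝ I))
    {ε : ℝ} (hε : 0 < ε) :
    ∃ z ∈ stdSimplex ℝ I, ∀ i, ∃ p ∈ stdSimplex ℝ I, dist p z ≤ ε ∧ p i ≤ f p i + ε := by
  classical
  obtain ⟨N, hN⟩ := exists_nat_gt (Fintype.card I / ε)
  have hN0 : 0 < N := by
    have : (0 : ℝ) < N := lt_of_le_of_lt (by positivity) hN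
    exact_mod_cast this
  have hNr : (0 : ℝ) < N := by exact_mod_cast hN0
  have hNε : (Fintype.card I : ℝ) / N ≤ ε := by
    rw [div_lt_iff₀ hε] at hN
    rw [div_le_iff₀ hNr]
    linarith
  let T := {v : I → Fin (N + 1) // ∑ i, (v i : ℕ) = N}
  have hmk : ∀ w : I → ℕ, ∑ i, w i = N → ∃ v : T, ∀ i, (v.1 i : ℕ) = w i := fun w hw =>
    ⟨⟨fun i => ⟨w i, Nat.lt_succ_of_le (hw ▸ Finset.single_le_sum (f := w) (fun _ _ => Nat.zero_le _)
      (Finset.mem_univ i))⟩, hw⟩, fun i => rfl⟩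
  have : Nonempty T := by
    obtain ⟨i⟩ := ‹Nonempty I›
    obtain ⟨v, -⟩ := hmk (Pi.single i N) (by simp)
    exact ⟨v⟩
  let pt : T → I → ℝ := fun v i => (v.1 i : ℕ) / (N : ℝ)
  have hpt : ∀ v, pt v ∈ stdSimplex ℝ I := fun v => by
    refine ⟨fun i => by positivity, ?_⟩
    simp only [pt, ← Finset.sum_div]
    rw [div_eq_one_iff_eq hNr.ne']
    exact_mod_cast v.2
  have hcol : ∀ v : T, ∃ i, pt v i ≤ f (pt v) i := fun v => by
    by_contra! h
    have := Finset.sum_lt_sum_of_nonempty Finset.univ_nonempty fun i _ => h i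
    rw [(hpt v).2, (hf (hpt v)).2] at this
    exact lt_irrefl _ this
  choose c hc using hcol
  let r : I → T → ℕ ×ₗ Fin (Fintype.card T) := fun i v =>
    toLex ((v.1 i : ℕ), Fintype.equivFin T v)
  have hr : ∀ i, Function.Injective (r i) := fun i v w h => by
    have := congrArg (fun p => (ofLex p).2) h
    exact (Fintype.equivFin T).injective this
  obtain ⟨σ, hσ⟩ := exists_scarfDominant_image hr c
  have hdom : ∀ y : T, ∃ i ∈ σ.image c, ∀ x ∈ σ, (y.1 i : ℕ) ≤ x.1 i := fun y => by
    obtain ⟨i, hi, h⟩ := hσ y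
    refine ⟨i, hi, fun x hx => ?_⟩
    have := Prod.Lex.le_iff.1 (h x hx)
    rcases this with h | h
    · exact h.le
    · exact h.1.le
  have hσne : σ.Nonempty := by
    obtain ⟨i, hi, -⟩ := hdom (Classical.arbitrary T)
    exact (Finset.mem_image.1 hi).imp fun _ h => h.1
  choose m hmσ hm using fun i => σ.exists_min_image (fun x => (x.1 i : ℕ)) hσne
  -- the coordinatewise minima over `σ` nearly exhaust the total mass
  have hbig : N < ∑ i ∈ σ.image c, ((m i).1 i + 1 : ℕ) := by
    by_contra! hle
    obtain ⟨v₀, hv₀⟩ := hσne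
    have hi₀ : c v₀ ∈ σ.image c := Finset.mem_image_of_mem _ hv₀
    set S := ∑ i ∈ σ.image c, ((m i).1 i + 1 : ℕ) with hS
    obtain ⟨v, hv⟩ := hmk (fun i => (if i ∈ σ.image c then ((m i).1 i + 1 : ℕ) else 0) +
      (if i = c v₀ then N - S else 0)) (by
        rw [Finset.sum_add_distrib, Finset.sum_ite_mem, Finset.univ_inter, ← hS]
        simp only [Finset.sum_ite_eq', Finset.mem_univ, if_true]
        omega)
    obtain ⟨i, hi, h⟩ := hdom v
    have := h (m i) (hmσ i)
    rw [hv, if_pos hi] at this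
    omega
  have hmass : N < ∑ i ∈ σ.image c, ((m i).1 i : ℕ) + Fintype.card I := by
    have hcardI : (σ.image c).card ≤ Fintype.card I := Finset.card_le_univ _
    rw [Finset.sum_add_distrib] at hbig
    simp only [Finset.sum_const, smul_eq_mul, mul_one] at hbig
    omega
  have hclose : ∀ x ∈ σ, ∀ y ∈ σ, ∀ i, (x.1 i : ℕ) ≤ y.1 i + Fintype.card I := by
    intro x hx y hy i
    have hxsum := x.2
    by_cases hi : i ∈ σ.image c
    · have h1 : ∑ j ∈ (σ.image c).erase i, ((m j).1 j : ℕ) ≤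
          ∑ j ∈ (σ.image c).erase i, (x.1 j : ℕ) := Finset.sum_le_sum fun j _ => hm j x hx
      have h2 := Finset.add_sum_erase (σ.image c) (fun j => ((m j).1 j : ℕ)) hi
      have h3 := Finset.add_sum_erase (σ.image c) (fun j => (x.1 j : ℕ)) hi
      have h4 : ∑ j ∈ σ.image c, (x.1 j : ℕ) ≤ ∑ j, (x.1 j : ℕ) :=
        Finset.sum_le_univ_sum_of_nonneg fun _ => Nat.zero_le _
      have h5 := hm i y hy
      omega
    · have h1 : ∑ j ∈ σ.image c, ((m j).1 j : ℕ) ≤ ∑ j ∈ σ.image c, (x.1 j : ℕ) :=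
        Finset.sum_le_sum fun j _ => hm j x hx
      have h3 := Finset.sum_insert (f := fun j => (x.1 j : ℕ)) hi
      have h4 : ∑ j ∈ insert i (σ.image c), (x.1 j : ℕ) ≤ ∑ j, (x.1 j : ℕ) :=
        Finset.sum_le_univ_sum_of_nonneg fun _ => Nat.zero_le _
      omega
  have hsmall : ∀ x ∈ σ, ∀ i ∉ σ.image c, (x.1 i : ℕ) ≤ Fintype.card I := by
    intro x hx i hi
    have h1 : ∑ j ∈ σ.image c, ((m j).1 j : ℕ) ≤ ∑ j ∈ σ.image c, (x.1 j : ℕ) :=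
      Finset.sum_le_sum fun j _ => hm j x hx
    have h3 := Finset.sum_insert (f := fun j => (x.1 j : ℕ)) hi
    have h4 : ∑ j ∈ insert i (σ.image c), (x.1 j : ℕ) ≤ ∑ j, (x.1 j : ℕ) :=
      Finset.sum_le_univ_sum_of_nonneg fun _ => Nat.zero_le _
    have hxsum := x.2
    omega
  have hsub : ∀ x ∈ σ, ∀ y ∈ σ, ∀ i, pt x i - pt y i ≤ ε := by
    intro x hx y hy i
    refine le_trans ?_ hNε
    simp only [pt, ← sub_div]
    have : ((x.1 i : ℕ) : ℝ) ≤ (y.1 i : ℕ) + Fintype.card I := by exact_mod_cast hclose x hx y hy i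
    gcongr
    linarith
  obtain ⟨v₀, hv₀⟩ := hσne
  refine ⟨pt v₀, hpt v₀, fun i => ?_⟩
  by_cases hi : i ∈ σ.image c
  · obtain ⟨x, hx, rfl⟩ := Finset.mem_image.1 hi
    refine ⟨pt x, hpt x, (dist_pi_le_iff hε.le).2 fun j => ?_, (hc x).trans (by linarith)⟩
    rw [Real.dist_eq, abs_le]
    constructor <;> linarith [hsub x hx v₀ hv₀ j, hsub v₀ hv₀ x hx j]
  · refine ⟨pt v₀, hpt v₀, by simpa using hε.le, ?_⟩
    have h1 : pt v₀ i ≤ ε := by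
      refine le_trans ?_ hNε
      have : ((v₀.1 i : ℕ) : ℝ) ≤ Fintype.card I := by exact_mod_cast hsmall v₀ hv₀ i hi
      simp only [pt]
      gcongr
    linarith [(hf (hpt v₀)).1 i]

/-- **Brouwer's fixed point theorem** for the standard simplex. -/
theorem exists_fixedPoint_stdSimplex {I : Type*} [Fintype I] [Nonempty I]
    {f : (I → ℝ) → (I → ℝ)} (hf : MapsTo f (stdSimplex ℝ I) (stdSimplex ℝ I))
    (hfc : ContinuousOn f (stdSimplex ℝ I)) : ∃ x ∈ stdSimplex ℝ I, f x = x := by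
  have hpos : ∀ n : ℕ, (0 : ℝ) < 1 / ((n : ℝ) + 1) := fun n => Nat.one_div_pos_of_nat
  choose z hz p hp hpz hpf using fun n : ℕ => exists_approx_le_stdSimplex f hf (hpos n)
  obtain ⟨x, hx, φ, hφ, hlim⟩ := (isCompact_stdSimplex ℝ I).tendsto_subseq hz
  have h0 : Tendsto (fun n => 1 / ((φ n : ℝ) + 1)) atTop (𝓝 0) :=
    tendsto_one_div_add_atTop_nhds_zero_nat.comp hφ.tendsto_atTop
  have hple : ∀ i, x i ≤ f x i := fun i => by
    have hplim : Tendsto (fun n => p (φ n) i) atTop (𝓝 x) := by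
      refine (tendsto_iff_of_dist ?_).1 hlim
      refine squeeze_zero (fun _ => dist_nonneg) (fun n => ?_) h0
      rw [dist_comm]
      exact hpz (φ n) i
    have hfp : Tendsto (fun n => f (p (φ n) i)) atTop (𝓝 (f x)) :=
      (hfc x hx).tendsto.comp (tendsto_nhdsWithin_iff.2 ⟨hplim, .of_forall fun n => hp _ i⟩)
    have := le_of_tendsto_of_tendsto' ((tendsto_pi_nhds.1 hplim) i)
      (((tendsto_pi_nhds.1 hfp) i).add h0) fun n => hpf (φ n) i
    simpa using this
  refine ⟨x, hx, funext fun i => ?_⟩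
  have := (Finset.sum_eq_sum_iff_of_le fun i _ => hple i).1 (hx.2.trans (hf hx).2.symm)
  exact (this i (Finset.mem_univ i)).symm

/-- **Schauder's fixed point theorem** for compact convex sets. -/
theorem exists_fixedPoint_of_isCompact_convex {E : Type*} [NormedAddCommGroup E] [NormedSpace ℝ E]
    {C : Set E} (hne : C.Nonempty) (hconv : Convex ℝ C) (hcomp : IsCompact C)
    {g : E → E} (hg : MapsTo g C C) (hgc : ContinuousOn g C) : ∃ x ∈ C, g x = x := by
  obtain ⟨x, hx, hmin⟩ := hcomp.exists_isMinOn hne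
    (f := fun x => dist (g x) x) (continuous_dist.comp_continuousOn (hgc.prodMk continuousOn_id))
  refine ⟨x, hx, ?_⟩
  by_contra hne'
  set ε := dist (g x) x / 2 with hε
  have hεpos : 0 < ε := half_pos (dist_pos.2 hne')
  obtain ⟨t, htC, htfin, hcov⟩ := hcomp.finite_cover_balls hεpos
  have : Fintype t := htfin.fintype
  let h : t → E → ℝ := fun i y => max 0 (ε - dist y i)
  have hh0 : ∀ i y, 0 ≤ h i y := fun i y => le_max_left _ _
  have hhc : ∀ i, Continuous (h i) := fun i => by fun_prop
  have hsum : ∀ y ∈ C, 0 < ∑ i, h i y := fun y hy => by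
    obtain ⟨i, hi, hyi⟩ := mem_iUnion₂.1 (hcov hy)
    refine Finset.sum_pos' (fun i _ => hh0 i y) ⟨⟨i, hi⟩, Finset.mem_univ _, ?_⟩
    exact lt_max_of_lt_right (sub_pos.2 hyi)
  have : Nonempty t := by
    obtain ⟨y, hy⟩ := hne
    obtain ⟨i, hi, -⟩ := mem_iUnion₂.1 (hcov hy)
    exact ⟨⟨i, hi⟩⟩
  let ψ : E → t → ℝ := fun y i => h i y / ∑ j, h j y
  let φ : (t → ℝ) → E := fun w => ∑ i, w i • (i : E)
  have hψ : MapsTo ψ C (stdSimplex ℝ t) := fun y hy => by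
    refine ⟨fun i => div_nonneg (hh0 i y) (hsum y hy).le, ?_⟩
    simp only [ψ, ← Finset.sum_div]
    exact div_self (hsum y hy).ne'
  have hφ : MapsTo φ (stdSimplex ℝ t) C := fun w hw =>
    hconv.sum_mem (fun i _ => hw.1 i) hw.2 fun i _ => htC i.2
  have hφc : Continuous φ := by fun_prop
  have hψc : ContinuousOn ψ C := continuousOn_pi.2 fun i =>
    (hhc i).continuousOn.div (by fun_prop) fun y hy => (hsum y hy).ne'
  have happrox : ∀ y ∈ C, dist y (φ (ψ y)) ≤ ε := fun y hy => by
    have hw := hψ hy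
    have e : y - φ (ψ y) = ∑ i, ψ y i • (y - (i : E)) := by
      simp only [smul_sub, Finset.sum_sub_distrib, ← Finset.sum_smul, hw.2, one_smul, φ]
    rw [dist_eq_norm, e]
    refine (norm_sum_le _ _).trans ?_
    calc ∑ i, ‖ψ y i • (y - (i : E))‖ ≤ ∑ i, ψ y i * ε := by
          refine Finset.sum_le_sum fun i _ => ?_
          rw [norm_smul, Real.norm_of_nonneg (hw.1 i), ← dist_eq_norm]
          by_cases hyi : dist y i ≤ ε
          · exact mul_le_mul_of_nonneg_left hyi (hw.1 i)
          · have : ψ y i = 0 := by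
              simp only [ψ, h]
              rw [max_eq_left (by linarith), zero_div]
            simp [this]
      _ = ε := by rw [← Finset.sum_mul, hw.2, one_mul]
  obtain ⟨w, hw, hfix⟩ := exists_fixedPoint_stdSimplex (f := ψ ∘ g ∘ φ)
    (hψ.comp (hg.comp hφ))
    (hψc.comp (hgc.comp hφc.continuousOn hφ) (hg.comp hφ))
  have h1 := happrox (g (φ w)) (hg (hφ hw))
  have h2 : φ (ψ (g (φ w))) = φ w := congrArg φ hfix
  rw [h2] at h1
  have h3 : dist (g x) x ≤ dist (g (φ w)) (φ w) := hmin (hφ hw)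
  linarith

section Selection

variable {X E : Type*}

theorem LscAt.inter_ball [TopologicalSpace X] [PseudoMetricSpace E] {Φ : X → Set E} {x : X}
    (h : LscAt Φ x) {f : X → E} (hf : ContinuousAt f x) (ε : ℝ) :
    LscAt (fun x => Φ x ∩ Metric.ball (f x) ε) x := by
  rintro Ω hΩ ⟨y, ⟨hyΦ, hyb⟩, hyΩ⟩
  have hδ : 0 < (ε - dist y (f x)) / 2 := half_pos (sub_pos.2 hyb)
  filter_upwards [h _ (hΩ.inter Metric.isOpen_ball) ⟨y, hyΦ, hyΩ, Metric.mem_ball_self hδ⟩,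
    hf (Metric.ball_mem_nhds _ hδ)] with x' ⟨z, hzΦ, hzΩ, hzy⟩ hx'
  refine ⟨z, ⟨hzΦ, ?_⟩, hzΩ⟩
  rw [mem_preimage, Metric.mem_ball'] at hx'
  rw [Metric.mem_ball] at hzy ⊢
  linarith [dist_triangle4 z y (f x) (f x')]

open Classical in
theorem LscAt.ite_inter [TopologicalSpace X] [TopologicalSpace E] {Φ : X → Set E} {x : X}
    (h : LscAt Φ x) {S : Set X} (hS : IsClosed S) {O : Set E} (hO : IsOpen O) :
    LscAt (fun x => if x ∈ S then Φ x ∩ O else Φ x) x := by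
  rintro Ω hΩ ⟨y, hy, hyΩ⟩
  by_cases hx : x ∈ S
  · simp only [hx, if_true] at hy
    filter_upwards [h _ (hO.inter hΩ) ⟨y, hy.1, hy.2, hyΩ⟩] with x' ⟨z, hz, hzO, hzΩ⟩
    refine ⟨z, ?_, hzΩ⟩
    split_ifs
    exacts [⟨hz, hzO⟩, hz]
  · simp only [hx, if_false] at hy
    filter_upwards [h _ hΩ ⟨y, hy, hyΩ⟩, hS.isOpen_compl.mem_nhds hx] with x' ⟨z, hz, hzΩ⟩ hx'
    refine ⟨z, ?_, hzΩ⟩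
    rwa [if_neg hx']

variable [NormedAddCommGroup E] [NormedSpace ℝ E]

theorem exists_continuous_mem_thickening [TopologicalSpace X] [NormalSpace X] [ParacompactSpace X]
    {Φ : X → Set E} (hlsc : ∀ x, LscAt Φ x) (hconv : ∀ x, Convex ℝ (Φ x))
    (hne : ∀ x, (Φ x).Nonempty) {ε : ℝ} (hε : 0 < ε) :
    ∃ g : C(X, E), ∀ x, g x ∈ Metric.thickening ε (Φ x) := by
  refine exists_continuous_forall_mem_convex_of_local_const
    (fun x => (hconv x).thickening ε) fun x => ?_
  obtain ⟨c, hc⟩ := hne x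
  refine ⟨c, ?_⟩
  filter_upwards [hlsc x _ Metric.isOpen_ball ⟨c, hc, Metric.mem_ball_self hε⟩]
    with x' ⟨z, hz, hzc⟩
  exact Metric.mem_thickening_iff.2 ⟨z, hz, Metric.mem_ball'.1 hzc⟩

/-- **Michael's selection theorem** over a compact base: a lower semicontinuous map with nonempty
convex values has a continuous selection of its closure. -/
theorem exists_continuous_mem_closure [TopologicalSpace X] [T2Space X] [CompactSpace X]
    [CompleteSpace E] {Φ : X → Set E} (hlsc : ∀ x, LscAt Φ x) (hconv : ∀ x, Convex ℝ (Φ x))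
    (hne : ∀ x, (Φ x).Nonempty) :
    ∃ g : C(X, E), ∀ x, g x ∈ closure (Φ x) := by
  let ε : ℕ → ℝ := fun n => (1 / 2) ^ n
  have hε : ∀ n, 0 < ε n := fun n => by positivity
  let P : ℕ → C(X, E) → Prop := fun n g => ∀ x, g x ∈ Metric.thickening (ε n) (Φ x)
  have step : ∀ n (g : C(X, E)), ∃ g' : C(X, E), P n g → P (n + 1) g' ∧ dist g g' ≤ 2 * ε n := by
    intro n g
    by_cases hg : P n g
    · obtain ⟨g', hg'⟩ := exists_continuous_mem_thickening
        (Φ := fun x => Φ x ∩ Metric.ball (g x) (ε n))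
        (fun x => (hlsc x).inter_ball g.continuous.continuousAt _)
        (fun x => (hconv x).inter (convex_ball _ _))
        (fun x => by
          obtain ⟨z, hz, hgz⟩ := Metric.mem_thickening_iff.1 (hg x)
          exact ⟨z, hz, Metric.mem_ball'.2 hgz⟩) (hε (n + 1))
      refine ⟨g', fun _ => ⟨fun x => Metric.thickening_subset_of_subset _ inter_subset_left (hg' x),
        (ContinuousMap.dist_le (by positivity)).2 fun x => ?_⟩⟩
      obtain ⟨z, ⟨-, hz⟩, hgz⟩ := Metric.mem_thickening_iff.1 (hg' x)
      have h1 : ε (n + 1) ≤ ε n := by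
        simp only [ε, pow_succ]
        linarith [hε n]
      linarith [dist_triangle (g x) z (g' x), Metric.mem_ball'.1 hz, dist_comm z (g' x)]
    · exact ⟨g, fun h => absurd h hg⟩
  choose F hF using step
  obtain ⟨g₀, hg₀⟩ := exists_continuous_mem_thickening hlsc hconv hne (hε 0)
  let u : ℕ → C(X, E) := fun n => Nat.rec g₀ F n
  have hu : ∀ n, P n (u n) := fun n => by
    induction n with
    | zero => exact hg₀
    | succ n ih => exact (hF n _ ih).1
  have hcau : CauchySeq u := cauchySeq_of_le_geometric (1 / 2) 2 (by norm_num)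
    fun n => (hF n _ (hu n)).2
  obtain ⟨g, hg⟩ := cauchySeq_tendsto_of_complete hcau
  refine ⟨g, fun x => Metric.mem_closure_iff.2 fun δ hδ => ?_⟩
  have h1 : Tendsto (fun n => dist (u n) g + ε n) atTop (𝓝 0) := by
    have := (tendsto_iff_dist_tendsto_zero.1 hg).add
      (tendsto_pow_atTop_nhds_zero_of_lt_one (r := (1 / 2 : ℝ)) (by norm_num) (by norm_num))
    simpa [ε] using this
  obtain ⟨n, hn⟩ := (h1.eventually_lt_const hδ).exists
  obtain ⟨z, hz, huz⟩ := Metric.mem_thickening_iff.1 (hu n x)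
  refine ⟨z, hz, ?_⟩
  have h2 := ContinuousMap.dist_apply_le_dist (f := u n) (g := g) x
  linarith [dist_triangle_left (g x) z (u n x)]

/-- The closure of a lower semicontinuous map with nonempty convex values is densely filled by
countably many continuous selections. -/
theorem exists_seq_continuous_dense [MetricSpace X] [CompactSpace X] [CompleteSpace E]
    [SecondCountableTopology E] {Φ : X → Set E} (hlsc : ∀ x, LscAt Φ x)
    (hconv : ∀ x, Convex ℝ (Φ x)) (hne : ∀ x, (Φ x).Nonempty) :
    ∃ q : ℕ → C(X, E), ∀ x, (∀ k, q k x ∈ closure (Φ x)) ∧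
      Φ x ⊆ closure (range fun k => q k x) := by
  classical
  let B : ℕ × ℕ → Set E := fun b =>
    Metric.ball (TopologicalSpace.denseSeq E b.1) (1 / ((b.2 : ℝ) + 1))
  have hU : ∀ b, IsOpen {x | (Φ x ∩ B b).Nonempty} := fun b =>
    isOpen_iff_mem_nhds.2 fun x hx => hlsc x _ Metric.isOpen_ball hx
  choose S hSc hSsub hSU _ using fun b => (hU b).exists_iUnion_isClosed
  have hsel : ∀ p : (ℕ × ℕ) × ℕ, ∃ g : C(X, E), ∀ x,
      g x ∈ closure (if x ∈ S p.1 p.2 then Φ x ∩ B p.1 else Φ x) := by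
    rintro ⟨b, j⟩
    refine exists_continuous_mem_closure
      (fun x => (hlsc x).ite_inter (hSc b j) Metric.isOpen_ball) (fun x => ?_) fun x => ?_
    · split_ifs
      exacts [(hconv x).inter (convex_ball _ _), hconv x]
    · split_ifs with hx
      exacts [hSsub b j hx, hne x]
  choose q hq using hsel
  obtain ⟨e, he⟩ := exists_surjective_nat ((ℕ × ℕ) × ℕ)
  refine ⟨fun k => q (e k), fun x => ⟨fun k => closure_mono ?_ (hq (e k) x), fun y hy => ?_⟩⟩
  · split_ifs
    exacts [inter_subset_left, Subset.rfl]
  · refine Metric.mem_closure_iff.2 fun δ hδ => ?_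
    obtain ⟨k, hk⟩ := exists_nat_one_div_lt (half_pos hδ)
    obtain ⟨m, hm⟩ := (TopologicalSpace.denseRange_denseSeq E).exists_dist_lt y
      (Nat.one_div_pos_of_nat (α := ℝ) (n := k))
    have hx : x ∈ ⋃ j, S (m, k) j := by
      rw [hSU]
      exact ⟨y, hy, hm⟩
    obtain ⟨j, hj⟩ := mem_iUnion.1 hx
    obtain ⟨n, hn⟩ := he ((m, k), j)
    refine ⟨_, mem_range_self n, ?_⟩
    have h := hq ((m, k), j) x
    simp only [hj, if_true] at h
    have h' := Metric.closure_ball_subset_closedBall (closure_mono inter_subset_right h)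
    simp only [hn]
    rw [Metric.mem_closedBall'] at h'
    simp only at h'
    linarith [dist_triangle y (TopologicalSpace.denseSeq E m) (q ((m, k), j) x)]

/-- A convex combination with positive weights of a sequence dense in the closure of a
finite-dimensional convex set `S` lies in `S`. -/
theorem Convex.mem_of_hasSum_dense [FiniteDimensional ℝ E] {S : Set E} (hS : Convex ℝ S)
    (hne : S.Nonempty) {q : ℕ → E} (hq : ∀ k, q k ∈ closure S) (hdense : S ⊆ closure (range q))
    {w : ℕ → ℝ} (hw : ∀ k, 0 < w k) (hw1 : HasSum w 1) {p : E}
    (hp : HasSum (fun k => w k • q k) p) : p ∈ S := by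
  obtain ⟨x₀, hx₀⟩ := hne
  set W : Submodule ℝ E := Submodule.span ℝ ((fun x => x - x₀) '' S) with hW
  have hSW : ∀ x ∈ S, x - x₀ ∈ W := fun x hx => Submodule.subset_span ⟨x, hx, rfl⟩
  have hWc : IsClosed (W : Set E) := W.closed_of_finiteDimensional
  have hqW : ∀ k, q k - x₀ ∈ W := fun k =>
    closure_minimal (s := S) (t := (fun x => x - x₀) ⁻¹' W) hSW
      (hWc.preimage (by fun_prop)) (hq k)
  have hp₀ : HasSum (fun k => w k • (q k - x₀)) (p - x₀) := by
    simpa [smul_sub] using hp.sub (hw1.smul_const x₀)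
  have hpW : p - x₀ ∈ W :=
    hWc.mem_of_tendsto hp₀ (.of_forall fun s => W.sum_mem fun k _ => W.smul_mem _ (hqW k))
  let T : Set W := (fun v : W => (v : E) + x₀) ⁻¹' S
  have hTconv : Convex ℝ T := by
    have : T = W.subtype ⁻¹' ((fun x => x + x₀) ⁻¹' S) := rfl
    rw [this]
    exact (hS.translate_preimage_left x₀).linear_preimage _
  have h0T : (0 : W) ∈ T := by simpa [T] using hx₀
  have hTspan : Submodule.span ℝ T = ⊤ := by
    have : T = Subtype.val ⁻¹' ((fun x => x - x₀) '' S) := by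
      ext v
      simp [T, sub_eq_iff_eq_add]
    rw [this]
    exact Submodule.span_span_coe_preimage
  have hTint : (interior T).Nonempty := by
    rw [hTconv.interior_nonempty_iff_affineSpan_eq_top, ← insert_eq_of_mem h0T,
      ← AffineSubspace.coe_eq_univ_iff, affineSpan_insert_zero, hTspan, Submodule.top_coe]
  by_contra hpS
  obtain ⟨f, hf⟩ := geometric_hahn_banach_open_point hTconv.interior isOpen_interior
    (x := (⟨p - x₀, hpW⟩ : W)) fun h => hpS (by simpa [T] using interior_subset h)
  obtain ⟨g, hg, -⟩ := exists_extension_norm_eq W f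
  have hgT : ∀ v ∈ T, f v ≤ f ⟨p - x₀, hpW⟩ := by
    have hsub : closure (interior T) ⊆ {v | f v ≤ f ⟨p - x₀, hpW⟩} :=
      closure_minimal (fun v hv => (hf v hv).le) (isClosed_le f.continuous continuous_const)
    rw [hTconv.closure_interior_eq_closure_of_nonempty_interior hTint] at hsub
    exact fun v hv => hsub (subset_closure hv)
  have hgS : ∀ x ∈ closure S, g x ≤ g p := fun x hx => by
    refine closure_minimal (t := {x | g x ≤ g p}) (fun x hx => ?_)
      (isClosed_le g.continuous continuous_const) hx
    have := hgT ⟨x - x₀, hSW x hx⟩ (by simpa [T] using hx)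
    rw [← hg, ← hg] at this
    simpa using this
  have hzero : HasSum (fun k => w k * (g p - g (q k))) 0 := by
    have h1 := (hw1.mul_right (g p)).sub (g.hasSum hp)
    simpa [mul_sub] using h1
  have hgq : ∀ k, g (q k) = g p := fun k => by
    have := (hasSum_zero_iff_of_nonneg fun k =>
      mul_nonneg (hw k).le (sub_nonneg.2 (hgS _ (hq k)))).1 hzero
    have := congrFun this k
    simp only [Pi.zero_apply, mul_eq_zero, (hw k).ne', false_or] at this
    linarith
  obtain ⟨v, hv⟩ := hTint
  have hvS : (v : E) + x₀ ∈ S := interior_subset (s := T) hv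
  have : g (v + x₀) = g p :=
    closure_minimal (t := {x | g x = g p}) (by rintro _ ⟨k, rfl⟩; exact hgq k)
      (isClosed_eq g.continuous continuous_const) (hdense hvS)
  have hlt := hf v hv
  rw [← hg, ← hg] at hlt
  simp only [map_sub, map_add] at this hlt
  linarith

/-- **Michael's selection theorem** in finite dimension: a bounded lower semicontinuous map with
nonempty convex values, closed or not, has a continuous selection. -/
theorem exists_continuous_selection [MetricSpace X] [CompactSpace X] [FiniteDimensional ℝ E]
    {Φ : X → Set E} (hlsc : ∀ x, LscAt Φ x) (hconv : ∀ x, Convex ℝ (Φ x))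
    (hne : ∀ x, (Φ x).Nonempty) {R : ℝ} (hR : ∀ x, ∀ y ∈ Φ x, ‖y‖ ≤ R) :
    ∃ g : C(X, E), ∀ x, g x ∈ Φ x := by
  have : CompleteSpace E := FiniteDimensional.complete ℝ E
  have : SecondCountableTopology E :=
    have := FiniteDimensional.proper_real E
    inferInstance
  obtain ⟨q, hq⟩ := exists_seq_continuous_dense hlsc hconv hne
  have hqR : ∀ k x, ‖q k x‖ ≤ R := fun k x =>
    closure_minimal (t := {y | ‖y‖ ≤ R}) (hR x) (isClosed_le continuous_norm continuous_const)
      ((hq x).1 k)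
  let w : ℕ → ℝ := fun k => 1 / 2 / 2 ^ k
  have hw : ∀ k, 0 < w k := fun k => by positivity
  have hw1 : HasSum w 1 := hasSum_geometric_two' 1
  have hbound : ∀ k x, ‖w k • q k x‖ ≤ w k * R := fun k x => by
    rw [norm_smul, Real.norm_of_nonneg (hw k).le]
    exact mul_le_mul_of_nonneg_left (hqR k x) (hw k).le
  have hsum := hw1.summable.mul_right R
  refine ⟨⟨fun x => ∑' k, w k • q k x, continuous_tsum (fun k => by fun_prop) hsum hbound⟩,
    fun x => ?_⟩
  exact (hconv x).mem_of_hasSum_dense (hne x) (hq x).1 (hq x).2 hw hw1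
    (Summable.of_norm_bounded hsum fun k => hbound k x).hasSum

end Selection

/-- Near a point `y` of a relatively open subset `U` of an affine subspace, the subspace is covered
by the convex hull of finitely many points of `U`. -/
theorem exists_finite_convexHull_nhds {E : Type*} [NormedAddCommGroup E] [NormedSpace ℝ E]
    [FiniteDimensional ℝ E] {P : AffineSubspace ℝ E} {U : Set E}
    (hU : IsOpen (Subtype.val ⁻¹' U : Set P)) {y : E} (hyP : y ∈ P) (hyU : y ∈ U) :
    ∃ t : Set E, t.Finite ∧ t ⊆ U ∧ ∃ V, IsOpen V ∧ y ∈ V ∧ V ∩ P ⊆ convexHull ℝ t := by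
  let j : P.direction → P := fun v => ⟨v + y, AffineSubspace.vadd_mem_of_mem_direction v.2 hyP⟩
  have hj : Continuous j := by fun_prop
  have hnhds : j ⁻¹' (Subtype.val ⁻¹' U) ∈ 𝓝 (0 : P.direction) :=
    (hU.preimage hj).mem_nhds (by simpa [j] using hyU)
  obtain ⟨b, hb0, hbU⟩ := exists_mem_interior_convexHull_affineBasis hnhds
  obtain ⟨V₀, hV₀, hV₀b⟩ := isOpen_induced_iff.1 (isOpen_interior (s := convexHull ℝ (range b)))
  refine ⟨range fun i => (b i : E) + y, finite_range _, ?_, (fun z => z - y) ⁻¹' V₀,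
    hV₀.preimage (by fun_prop), ?_, ?_⟩
  · rintro _ ⟨i, rfl⟩
    exact hbU (subset_convexHull ℝ _ (mem_range_self i))
  · rw [← hV₀b] at hb0
    simpa using hb0
  · rintro z ⟨hzV, hzP⟩
    have hzy : z - y ∈ P.direction := AffineSubspace.vsub_mem_direction hzP hyP
    have hmem : (⟨z - y, hzy⟩ : P.direction) ∈ convexHull ℝ (range b) := by
      refine interior_subset (s := convexHull ℝ (range b)) ?_
      rw [← hV₀b]
      exact hzV
    have hconv : Convex ℝ (P.direction.subtype ⁻¹'
        ((fun x => x + y) ⁻¹' convexHull ℝ (range fun i => (b i : E) + y))) :=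
      ((convex_convexHull ℝ _).translate_preimage_left y).linear_preimage _
    have := convexHull_min (s := range b) (by
      rintro _ ⟨i, rfl⟩
      exact subset_convexHull ℝ _ (mem_range_self i)) hconv hmem
    simpa using this

/-- Theorem 3.2: existence for the quasiequilibrium problem via an extension `f̂` of the
bifunction `f` to `C × A`, where `A ⊇ C` is open in the affine hull of `C`. The extended
map `F̂ x := {y ∈ A : f̂ x y < 0}` is assumed convex-valued on `fix K`, with lower sections
open in the relative topology of `fix K`, and with values open in `aff C` at all points of
`∂_C fix K`. -/
theorem quasiequilibrium_existence_affine_extension {n : ℕ} {C : Set (Fin n → ℝ)}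
    (hCne : C.Nonempty) (hCconv : Convex ℝ C) (hCcomp : IsCompact C)
    (f : C → C → ℝ) (hdiag : ∀ x : C, f x x = 0)
    (K : C → Set C)
    (hKlsc : ∀ x : C, LscAt K x)
    (hKne : ∀ x : C, (K x).Nonempty)
    (hKconv : ∀ x : C, Convex ℝ (Subtype.val '' K x))
    (hfix : IsClosed {x : C | x ∈ K x})
    (A : Set (Fin n → ℝ)) (hCA : C ⊆ A) (hAaff : A ⊆ (affineSpan ℝ C : Set (Fin n → ℝ)))
    (hAopen : IsOpen (Subtype.val ⁻¹' A : Set (affineSpan ℝ C)))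
    (fhat : C → (Fin n → ℝ) → ℝ)
    (hfhat : ∀ x y : C, fhat x (y : Fin n → ℝ) = f x y)
    (Fhat : C → Set (Fin n → ℝ))
    (hFhat : ∀ x : C, Fhat x = {y | y ∈ A ∧ fhat x y < 0})
    (hFhatconv : ∀ x ∈ {x : C | x ∈ K x}, Convex ℝ (Fhat x))
    (hFhatsec : ∀ y ∈ A,
      IsOpen ((fun z : {x : C | x ∈ K x} => (z : C)) ⁻¹' {x : C | y ∈ Fhat x}))
    (hFhatopen : ∀ x ∈ frontier {x : C | x ∈ K x},
      IsOpen (Subtype.val ⁻¹' Fhat x : Set (affineSpan ℝ C))) :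
    ∃ x : C, x ∈ K x ∧ ∀ y ∈ K x, 0 ≤ f x y := by
  classical
  by_contra! hno
  have : CompactSpace C := isCompact_iff_compactSpace.1 hCcomp
  set S : Set C := {x : C | x ∈ K x} with hS
  have hdiag' : ∀ x : C, (x : Fin n → ℝ) ∉ Fhat x := fun x hx => by
    rw [hFhat] at hx
    have := hx.2
    rw [hfhat, hdiag] at this
    exact lt_irrefl _ this
  have hFA : ∀ x, Fhat x ⊆ A := fun x y hy => by
    rw [hFhat] at hy
    exact hy.1
  have hsec : ∀ x ∈ S, ∀ y ∈ Fhat x, ∀ᶠ x' in 𝓝 x, x' ∈ S → y ∈ Fhat x' := by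
    intro x hx y hy
    obtain ⟨O, hO, hOS⟩ := isOpen_induced_iff.1 (hFhatsec y (hFA x hy))
    have hmem : ∀ z (hz : z ∈ S), z ∈ O ↔ y ∈ Fhat z := fun z hz =>
      Set.ext_iff.1 hOS ⟨z, hz⟩
    filter_upwards [hO.mem_nhds ((hmem x hx).2 hy)] with z hzO hz
    exact (hmem z hz).1 hzO
  let Φ : C → Set (Fin n → ℝ) := fun x =>
    if x ∈ interior S then Fhat x ∩ C
    else if x ∈ S then Fhat x ∩ Subtype.val '' K x else Subtype.val '' K x
  have hKsub : ∀ x, Subtype.val '' K x ⊆ C := fun x => by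
    rintro _ ⟨z, -, rfl⟩
    exact z.2
  have hΦC : ∀ x, Φ x ⊆ C := fun x => by
    simp only [Φ]
    split_ifs
    exacts [inter_subset_right, inter_subset_right.trans (hKsub x), hKsub x]
  have hΦconv : ∀ x, Convex ℝ (Φ x) := fun x => by
    simp only [Φ]
    split_ifs with h1 h2
    exacts [(hFhatconv x (interior_subset h1)).inter hCconv, (hFhatconv x h2).inter (hKconv x),
      hKconv x]
  have hmeet : ∀ x ∈ S, (Fhat x ∩ Subtype.val '' K x).Nonempty := fun x hx => by
    obtain ⟨y, hy, hlt⟩ := hno x hx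
    refine ⟨y, ?_, y, hy, rfl⟩
    rw [hFhat]
    exact ⟨hCA y.2, by rwa [hfhat]⟩
  have hΦne : ∀ x, (Φ x).Nonempty := fun x => by
    simp only [Φ]
    split_ifs with h1 h2
    exacts [(hmeet x (interior_subset h1)).mono (inter_subset_inter_right _ (hKsub x)), hmeet x h2,
      (hKne x).image _]
  have hKlsc' : ∀ x, ∀ Ω : Set (Fin n → ℝ), IsOpen Ω → (Subtype.val '' K x ∩ Ω).Nonempty →
      ∀ᶠ x' in 𝓝 x, (Subtype.val '' K x' ∩ Ω).Nonempty := by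
    rintro x Ω hΩ ⟨_, ⟨y, hy, rfl⟩, hyΩ⟩
    filter_upwards [hKlsc x _ (hΩ.preimage continuous_subtype_val) ⟨y, hy, hyΩ⟩]
      with x' ⟨z, hz, hzΩ⟩
    exact ⟨z, ⟨z, hz, rfl⟩, hzΩ⟩
  have hΦlsc : ∀ x, LscAt Φ x := by
    rintro x Ω hΩ ⟨y, hy, hyΩ⟩
    simp only [Φ] at hy
    split_ifs at hy with h1 h2
    · filter_upwards [isOpen_interior.mem_nhds h1, hsec x (interior_subset h1) y hy.1]
        with x' hx' hyx'
      refine ⟨y, ?_, hyΩ⟩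
      simp only [Φ, if_pos hx']
      exact ⟨hyx' (interior_subset hx'), hy.2⟩
    · have hfr : x ∈ frontier S := by
        rw [hfix.frontier_eq]
        exact ⟨h2, h1⟩
      obtain ⟨t, htfin, htF, V, hV, hyV, hVt⟩ :=
        exists_finite_convexHull_nhds (hFhatopen x hfr) (hAaff (hFA x hy.1)) hy.1
      have hev : ∀ᶠ x' in 𝓝 x, ∀ z ∈ t, x' ∈ S → z ∈ Fhat x' :=
        (eventually_all_finite htfin).2 fun z hz => hsec x h2 z (htF hz)
      filter_upwards [hev, hKlsc' x (V ∩ Ω) (hV.inter hΩ) ⟨y, hy.2, hyV, hyΩ⟩]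
        with x' hx' ⟨z, hzK, hzV, hzΩ⟩
      have hzF : x' ∈ S → z ∈ Fhat x' := fun hx'S =>
        convexHull_min (fun w hw => hx' w hw hx'S) (hFhatconv x' hx'S)
          (hVt ⟨hzV, subset_affineSpan ℝ C (hKsub x' hzK)⟩)
      refine ⟨z, ?_, hzΩ⟩
      simp only [Φ]
      split_ifs with h3 h4
      exacts [⟨hzF (interior_subset h3), hKsub x' hzK⟩, ⟨hzF h4, hzK⟩, hzK]
    · filter_upwards [hfix.isOpen_compl.mem_nhds h2, hKlsc' x Ω hΩ ⟨y, hy, hyΩ⟩]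
        with x' hx' ⟨z, hzK, hzΩ⟩
      refine ⟨z, ?_, hzΩ⟩
      simp only [Φ, if_neg hx', if_neg fun h => hx' (interior_subset h)]
      exact hzK
  obtain ⟨R, hR⟩ := hCcomp.isBounded.exists_norm_le
  obtain ⟨g, hg⟩ := exists_continuous_selection hΦlsc hΦconv hΦne
    fun x y hy => hR y (hΦC x hy)
  let g' : (Fin n → ℝ) → (Fin n → ℝ) := fun e => if h : e ∈ C then g ⟨e, h⟩ else 0
  have hg' : ∀ x : C, g' x = g x := fun x => dif_pos x.2
  obtain ⟨x, hxC, hx⟩ := exists_fixedPoint_of_isCompact_convex hCne hCconv hCcomp (g := g')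
    (fun e he => hg' ⟨e, he⟩ ▸ hΦC _ (hg ⟨e, he⟩))
    (continuousOn_iff_continuous_domRestrict.2 (g.continuous.congr fun x => (hg' x).symm))
  have hxΦ := hg ⟨x, hxC⟩
  rw [← hg', hx] at hxΦ
  simp only [Φ] at hxΦ
  split_ifs at hxΦ with h1 h2
  · exact hdiag' _ hxΦ.1
  · exact hdiag' _ hxΦ.1
  · obtain ⟨z, hz, hzx⟩ := hxΦ
    exact h2 ((Subtype.ext hzx : z = ⟨x, hxC⟩) ▸ hz)
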